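/- Let G be a simple graph and let e = uv be an edge of G. Then per L(G) = per L(G−e) + per L_v(G−e) + per L_u(G−e) + 2·per L_{uv}(G) + 2·Σ_{C∈𝒞_G(e)} (−1)^{|V(C)|}·per L_{V(C)}(G), where G−e is the graph obtained from G by deleting the edge e and 𝒞_G(e) is the set of cycles of G (as subgraphs) containing the edge e. -/

import Mathlib

open scoped Classical

/-- Permanent of the Laplacian matrix of `G` (over `ℝ`). -/
noncomputable def permL {V : Type*} [Fintype V] (G : SimpleGraph V) : ℝ :=
  (G.lapMatrix ℝ).permanent

/-- Permanent of the principal submatrix of the Laplacian of `G` obtained by deleting the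
rows and columns indexed by vertices in `S`. -/
noncomputable def permDel {V : Type*} [Fintype V] (G : SimpleGraph V) (S : Set V) : ℝ :=
  ((G.lapMatrix ℝ).submatrix (fun i : ↥(Sᶜ) => (i : V)) (fun i : ↥(Sᶜ) => (i : V))).permanent

/-- A subgraph is a cycle subgraph if it is the subgraph traced out by some cycle walk. -/
def IsCycleSubgraph {V : Type*} (G : SimpleGraph V) (C : G.Subgraph) : Prop :=
  ∃ (x : V) (w : G.Walk x x), w.IsCycle ∧ w.toSubgraph = C

open Equiv in
/-- Permutations with a prescribed action `c` on `S` correspond to permutations of `Sᶜ`. -/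
lemma sum_prod_compl_of_agree {V : Type*} [Fintype V] (G : SimpleGraph V) (S : Set V) (c : Perm V)
    (hc : ∀ i, i ∉ S → c i = i) :
    ∑ σ : Perm V with ∀ i ∈ S, σ i = c i, ∏ i with i ∉ S, G.lapMatrix ℝ (σ i) i =
      permDel G S := by
  have hcS : ∀ i, c i ∈ S ↔ i ∈ S := by
    refine fun i => ⟨fun h => ?_, fun h => ?_⟩ <;> by_contra h'
    · exact h' (by rwa [hc i h'] at h)
    · exact h' (by rwa [c.injective (hc _ h')])
  symm
  refine Finset.sum_bij
    (fun (τ : Perm ↥(Sᶜ)) _ => c * Perm.ofSubtype (p := fun i => i ∈ Sᶜ) τ) ?_ ?_ ?_ ?_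
  · intro τ _
    simp only [Finset.mem_filter_univ, Perm.mul_apply]
    exact fun i hi => congrArg c (Perm.ofSubtype_apply_of_not_mem τ (not_not.2 hi))
  · exact fun τ _ τ' _ h => Perm.ofSubtype_injective (mul_left_cancel h)
  · intro σ hσ
    have hfix : ∀ i ∈ S, (c⁻¹ * σ) i = i := fun i hi => by
      simp [(Finset.mem_filter_univ _).1 hσ i hi]
    have hmem : ∀ i, (c⁻¹ * σ) i ∈ Sᶜ ↔ i ∈ Sᶜ := by
      refine fun i => not_congr ⟨fun h => ?_, fun h => (hfix i h).symm ▸ h⟩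
      exact (c⁻¹ * σ).injective (hfix _ h) ▸ h
    refine ⟨(c⁻¹ * σ).subtypePerm hmem, Finset.mem_univ _, ?_⟩
    rw [Perm.ofSubtype_subtypePerm hmem fun i hi his => hi (hfix i his), mul_inv_cancel_left]
  · intro τ _
    rw [← Finset.prod_subtype_eq_prod_filter, Finset.subtype_univ]
    refine Finset.prod_congr rfl fun i _ => ?_
    have hi : Perm.ofSubtype (p := fun i => i ∈ Sᶜ) τ i = τ i := Perm.ofSubtype_apply_coe τ i
    rw [Matrix.submatrix_apply, Perm.mul_apply, hi, hc _ (τ i).2]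

open Equiv in
lemma sum_prod_of_agree {V : Type*} [Fintype V] (G : SimpleGraph V) (S : Set V) (c : Perm V)
    (hc : ∀ i, i ∉ S → c i = i) :
    ∑ σ : Perm V with ∀ i ∈ S, σ i = c i, ∏ i, G.lapMatrix ℝ (σ i) i =
      (∏ i with i ∈ S, G.lapMatrix ℝ (c i) i) * permDel G S := by
  rw [← sum_prod_compl_of_agree G S c hc, Finset.mul_sum]
  refine Finset.sum_congr rfl fun σ hσ => ?_
  rw [← Finset.prod_filter_mul_prod_filter_not _ (· ∈ S)]
  congr 1
  refine Finset.prod_congr rfl fun i hi => ?_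
  rw [(Finset.mem_filter_univ _).1 hσ i ((Finset.mem_filter_univ _).1 hi)]

open Equiv in
/-- Grouping the permutations with `σ u = v`, `σ v ≠ u` by the cycle through `u`. -/
lemma sum_prod_eq_sum_cycle {V : Type*} [Fintype V] (G : SimpleGraph V) {u v : V} (huv : u ≠ v) :
    ∑ σ : Perm V with σ u = v ∧ σ v ≠ u, ∏ i, G.lapMatrix ℝ (σ i) i =
      ∑ c : Perm V with c.IsCycle ∧ c u = v ∧ c v ≠ u,
        (∏ i with c i ≠ i, G.lapMatrix ℝ (c i) i) * permDel G {i | c i ≠ i} := by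
  have hmaps : ∀ σ ∈ ({σ : Perm V | σ u = v ∧ σ v ≠ u} : Finset (Perm V)), σ.cycleOf u ∈
      ({c : Perm V | c.IsCycle ∧ c u = v ∧ c v ≠ u} : Finset (Perm V)) := by
    intro σ hσ
    obtain ⟨h₁, h₂⟩ := (Finset.mem_filter_univ _).1 hσ
    refine (Finset.mem_filter_univ _).2 ⟨σ.isCycle_cycleOf (h₁ ▸ huv.symm), ?_, ?_⟩
    · rwa [Perm.cycleOf_apply_self]
    · rwa [← h₁, Perm.cycleOf_apply_apply_self, h₁]
  rw [← Finset.sum_fiberwise_of_maps_to hmaps]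
  refine Finset.sum_congr rfl fun c hc => ?_
  obtain ⟨hcyc, hcu, hcv⟩ := (Finset.mem_filter_univ _).1 hc
  have hcv' : c v ≠ v := fun h => huv (c.injective (hcu.trans h.symm))
  refine Eq.trans ?_
    ((sum_prod_of_agree G {i | c i ≠ i} c fun i hi => not_not.1 hi).trans
      (congrArg₂ (· * ·) (Finset.prod_congr (by ext; simp) fun _ _ => rfl) rfl))
  congr 1
  ext σ
  simp only [Finset.mem_filter, Finset.mem_univ, true_and]
  constructor
  · rintro ⟨-, rfl⟩ i hi
    rw [Perm.SameCycle.cycleOf_apply]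
    by_contra h
    exact hi (Perm.cycleOf_apply_of_not_sameCycle h)
  · intro h
    refine ⟨⟨?_, ?_⟩, ?_⟩
    · rw [h u (hcu.symm ▸ huv.symm : c u ≠ u), hcu]
    · rwa [h v hcv']
    · refine (Perm.cycle_is_cycleOf (f := σ) (Perm.mem_support.2 (hcu.symm ▸ huv.symm : c u ≠ u))
        (Perm.mem_cycleFactorsFinset_iff.2 ⟨hcyc, fun a ha => ?_⟩)).symm
      exact (h a (Perm.mem_support.1 ha)).symm

/-- The subgraph of `G` whose edges join `a` to `c a`, on the vertices moved by `c`. -/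
def permSubgraph {V : Type*} (G : SimpleGraph V) (c : Equiv.Perm V) : G.Subgraph where
  verts := {i | c i ≠ i}
  Adj a b := G.Adj a b ∧ (c a = b ∨ c b = a)
  adj_sub h := h.1
  edge_vert := by
    rintro a b ⟨hab, rfl | h⟩
    · exact hab.ne'
    · exact fun h' => hab.ne (c.injective (h'.trans h.symm))
  symm := ⟨fun _ _ h => ⟨h.1.symm, h.2.symm⟩⟩

lemma exists_walk_perm_pow {V : Type*} {G : SimpleGraph V} {c : Equiv.Perm V}
    (hadj : ∀ i, c i ≠ i → G.Adj i (c i)) (n : ℕ) :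
    ∀ x y, c x ≠ x → (c ^ n) x = y →
      ∃ w : G.Walk x y, w.length = n ∧ ∀ i ≤ n, w.getVert i = (c ^ i) x := by
  induction n with
  | zero =>
    intro x y _ hxy
    obtain rfl : x = y := by simpa using hxy
    exact ⟨.nil, rfl, by simp⟩
  | succ n ih =>
    rintro x y hx rfl
    obtain ⟨w, hw, hv⟩ := ih (c x) ((c ^ (n + 1)) x) (fun h => hx (c.injective h))
      (by rw [pow_succ, Equiv.Perm.mul_apply])
    refine ⟨.cons (hadj x hx) w, by simp [hw], fun i hi => ?_⟩
    cases i with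
    | zero => simp
    | succ i => rw [SimpleGraph.Walk.getVert_cons_succ, hv i (by lia), pow_succ, Equiv.Perm.mul_apply]

lemma isCycleSubgraph_permSubgraph {V : Type*} [Fintype V] {G : SimpleGraph V} {u v : V}
    (huv : u ≠ v) {c : Equiv.Perm V} (hc : c.IsCycle) (hcu : c u = v) (hcv : c v ≠ u)
    (hadj : ∀ i, c i ≠ i → G.Adj i (c i)) : IsCycleSubgraph G (permSubgraph G c) := by
  have hu : c u ≠ u := hcu ▸ huv.symm
  obtain ⟨w, hw, hget⟩ := exists_walk_perm_pow hadj (orderOf c) u u hu (by simp [pow_orderOf_eq_one])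
  have hinj : ∀ i j, i < orderOf c → j < orderOf c → (c ^ i) u = (c ^ j) u → i = j :=
    fun i j hi hj h => pow_injOn_Iio_orderOf hi hj (hc.pow_eq_pow_iff.2 ⟨u, hu, h⟩)
  have hpos : 0 < orderOf c := orderOf_pos c
  have h3 : 3 ≤ orderOf c := by
    by_contra! h
    interval_cases h' : orderOf c
    · exact hu (by simp [orderOf_eq_one_iff.1 h'])
    · have := pow_orderOf_eq_one c
      rw [h'] at this
      apply hcv
      rw [← hcu, ← Equiv.Perm.mul_apply, ← pow_two, this, Equiv.Perm.one_apply]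
  refine ⟨u, w, SimpleGraph.Walk.isCycle_iff_isPath_tail_and_le_length.2 ⟨?_, hw ▸ h3⟩, ?_⟩
  · rw [← SimpleGraph.Walk.IsPath.getVert_injOn_iff]
    intro i hi j hj h
    simp only [Set.mem_ofPred_eq, SimpleGraph.Walk.length_tail, hw] at hi hj
    rw [SimpleGraph.Walk.getVert_tail, SimpleGraph.Walk.getVert_tail, hget _ (by lia),
      hget _ (by lia), pow_succ', pow_succ', Equiv.Perm.mul_apply, Equiv.Perm.mul_apply] at h
    exact hinj i j (by lia) (by lia) (c.injective h)
  · have hmem : ∀ a, c a ≠ a → ∃ i < orderOf c, (c ^ i) u = a := fun a ha => by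
      obtain ⟨i, hi⟩ := hc.exists_pow_eq hu ha
      exact ⟨i % orderOf c, Nat.mod_lt _ hpos, by rw [pow_mod_orderOf, hi]⟩
    have hmove : ∀ i, c ((c ^ i) u) ≠ (c ^ i) u := fun i h => by
      rw [← Equiv.Perm.mul_apply, ← pow_succ', pow_succ, Equiv.Perm.mul_apply] at h
      exact hu ((c ^ i).injective h)
    ext a b
    · rw [SimpleGraph.Walk.mem_verts_toSubgraph, SimpleGraph.Walk.mem_support_iff_exists_getVert]
      constructor
      · rintro ⟨i, rfl, hi⟩
        rw [hget i (hw ▸ hi)]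
        exact hmove i
      · intro ha
        obtain ⟨i, hi, rfl⟩ := hmem a ha
        exact ⟨i, hget i hi.le, by lia⟩
    · rw [SimpleGraph.Walk.toSubgraph_adj_iff]
      constructor
      · rintro ⟨i, he, hi⟩
        rw [hget i (by lia), hget (i + 1) (by lia), pow_succ', Equiv.Perm.mul_apply] at he
        obtain ⟨rfl, rfl⟩ | ⟨rfl, rfl⟩ := Sym2.eq_iff.1 he
        · exact ⟨hadj _ (hmove i), .inl rfl⟩
        · exact ⟨(hadj _ (hmove i)).symm, .inr rfl⟩
      · rintro ⟨hab, rfl | rfl⟩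
        · obtain ⟨i, hi, rfl⟩ := hmem a hab.ne'
          refine ⟨i, ?_, by lia⟩
          rw [hget i (by lia), hget (i + 1) (by lia), pow_succ', Equiv.Perm.mul_apply]
        · obtain ⟨i, hi, rfl⟩ := hmem b hab.ne
          refine ⟨i, ?_, by lia⟩
          rw [hget i (by lia), hget (i + 1) (by lia), pow_succ', Equiv.Perm.mul_apply, Sym2.eq_swap]

lemma permSubgraph_injOn {V : Type*} [Fintype V] {G : SimpleGraph V} {u v : V} (huv : u ≠ v)
    {c d : Equiv.Perm V} (hc : c.IsCycle) (hcu : c u = v) (hdu : d u = v)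
    (hdv : d v ≠ u) (hadj : ∀ i, d i ≠ i → G.Adj i (d i))
    (h : permSubgraph G c = permSubgraph G d) : c = d := by
  have hu : c u ≠ u := hcu ▸ huv.symm
  have hmove : ∀ i, d ((d ^ i) u) ≠ (d ^ i) u := fun i h => by
    rw [← Equiv.Perm.mul_apply, ← pow_succ', pow_succ, Equiv.Perm.mul_apply] at h
    exact huv ((d ^ i).injective h ▸ hdu)
  have hmove₂ : ∀ i, d (d ((d ^ i) u)) ≠ (d ^ i) u := fun i h => by
    rw [← Equiv.Perm.mul_apply, ← Equiv.Perm.mul_apply, mul_assoc, ← pow_succ', ← pow_succ', pow_succ,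
      pow_succ, Equiv.Perm.mul_apply, Equiv.Perm.mul_apply, hdu] at h
    exact hdv ((d ^ i).injective h)
  have key : ∀ i, (c ^ i) u = (d ^ i) u ∧ c ((d ^ i) u) = d ((d ^ i) u) := by
    intro i
    induction i with
    | zero => simp [hcu, hdu]
    | succ i ih =>
      have h₁ : (c ^ (i + 1)) u = (d ^ (i + 1)) u := by
        rw [pow_succ', pow_succ', Equiv.Perm.mul_apply, Equiv.Perm.mul_apply, ih.1, ih.2]
      refine ⟨h₁, ?_⟩
      have hd : (permSubgraph G d).Adj ((d ^ (i + 1)) u) (d ((d ^ (i + 1)) u)) :=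
        ⟨hadj _ (hmove _), .inl rfl⟩
      rw [← h] at hd
      refine hd.2.resolve_right fun h' => hmove₂ i ?_
      have hs : d ((d ^ i) u) = (d ^ (i + 1)) u := by rw [pow_succ', Equiv.Perm.mul_apply]
      apply c.injective
      rw [ih.2, hs, h']
  ext a
  by_cases ha : c a = a
  · have : a ∉ (permSubgraph G d).verts := h ▸ not_not.2 ha
    rw [ha, not_not.1 this]
  · obtain ⟨i, rfl⟩ := hc.exists_pow_eq hu ha
    rw [(key i).1, (key i).2]

lemma exists_isCycle_snd_eq {V : Type*} {G : SimpleGraph V} {u v : V} {C : G.Subgraph}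
    (hC : IsCycleSubgraph G C) (hadj : C.Adj u v) :
    ∃ w : G.Walk u u, w.IsCycle ∧ w.snd = v ∧ w.toSubgraph = C := by
  obtain ⟨x, w, hw, rfl⟩ := hC
  have hu : u ∈ w.support := SimpleGraph.Walk.mem_support_of_adj_toSubgraph hadj
  have hr : (w.rotate u hu).IsCycle := hw.rotate hu
  rw [← w.toSubgraph_rotate hu] at hadj
  have : v ∈ (w.rotate u hu).toSubgraph.neighborSet u := hadj
  rw [hr.neighborSet_toSubgraph_endpoint] at this
  obtain h | h := this
  · exact ⟨_, hr, h.symm, w.toSubgraph_rotate hu⟩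
  · exact ⟨_, hr.reverse, by rw [SimpleGraph.Walk.snd_reverse, h],
      by rw [SimpleGraph.Walk.toSubgraph_reverse, w.toSubgraph_rotate hu]⟩

lemma exists_permSubgraph_eq {V : Type*} [Fintype V] {G : SimpleGraph V} {u v : V}
    {C : G.Subgraph} (hC : IsCycleSubgraph G C) (huv : C.Adj u v) :
    ∃ c : Equiv.Perm V, (c.IsCycle ∧ c u = v ∧ c v ≠ u) ∧ (∀ i, c i ≠ i → G.Adj i (c i)) ∧
      permSubgraph G c = C := by
  obtain ⟨w, hw, rfl, rfl⟩ := exists_isCycle_snd_eq hC huv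
  have hnd : w.support.tail.Nodup := hw.support_nodup
  have h3 : 3 ≤ w.length := hw.three_le_length
  have hlen : w.support.tail.length = w.length := by simp
  have hget : ∀ i (hi : i < w.support.tail.length), w.support.tail[i] = w.getVert (i + 1) := by
    intro i hi
    rw [List.getElem_tail, SimpleGraph.Walk.support_getElem_eq_getVert]
  set c := w.support.tail.formPerm with hcdef
  have hc : ∀ i < w.length, c (w.getVert i) = w.getVert (i + 1) := by
    intro i hi
    cases i with
    | zero =>
      have := List.formPerm_apply_getElem _ hnd (w.length - 1) (by lia)
      rw [hget, hget] at this
      simp only [hlen, Nat.sub_add_cancel (by lia : 1 ≤ w.length), Nat.mod_self,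
        SimpleGraph.Walk.getVert_length] at this
      simpa using this
    | succ i =>
      have := List.formPerm_apply_getElem _ hnd i (by lia)
      rw [hget, hget] at this
      simpa only [hlen, Nat.mod_eq_of_lt hi] using this
  have hmem : ∀ a, a ∈ w.support ↔ ∃ i < w.length, w.getVert i = a := by
    intro a
    rw [SimpleGraph.Walk.mem_support_iff_exists_getVert]
    constructor
    · rintro ⟨i, rfl, hi⟩
      obtain rfl | hi := hi.eq_or_lt
      · exact ⟨0, by lia, by simp⟩
      · exact ⟨i, hi, rfl⟩
    · rintro ⟨i, hi, rfl⟩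
      exact ⟨i, rfl, hi.le⟩
  have hmoved : ∀ a, c a ≠ a ↔ a ∈ w.support := by
    intro a
    constructor
    · exact fun h => List.mem_of_mem_tail (List.mem_of_formPerm_apply_ne h)
    · rw [hmem]
      rintro ⟨i, hi, rfl⟩
      rw [hc i hi]
      exact (w.adj_getVert_succ hi).ne'
  have hadj : ∀ a, c a ≠ a → G.Adj a (c a) := by
    intro a ha
    obtain ⟨i, hi, rfl⟩ := (hmem a).1 ((hmoved a).1 ha)
    rw [hc i hi]
    exact w.adj_getVert_succ hi
  refine ⟨c, ⟨List.isCycle_formPerm hnd (by lia), ?_, ?_⟩, hadj, ?_⟩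
  · simpa using hc 0 (by lia)
  · rw [SimpleGraph.Walk.snd, hc 1 (by lia)]
    intro h
    have := (hw.getVert_endpoint_iff (by lia : 1 + 1 ≤ w.length)).1 h
    lia
  · ext a b
    · rw [SimpleGraph.Walk.mem_verts_toSubgraph]
      exact hmoved a
    · rw [SimpleGraph.Walk.toSubgraph_adj_iff]
      constructor
      · rintro ⟨hab, rfl | rfl⟩
        · obtain ⟨i, hi, rfl⟩ := (hmem a).1 ((hmoved a).1 hab.ne')
          exact ⟨i, by rw [hc i hi], hi⟩
        · obtain ⟨i, hi, rfl⟩ := (hmem b).1 ((hmoved b).1 hab.ne)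
          exact ⟨i, by rw [hc i hi, Sym2.eq_swap], hi⟩
      · rintro ⟨i, he, hi⟩
        have := w.adj_getVert_succ hi
        obtain ⟨rfl, rfl⟩ | ⟨rfl, rfl⟩ := Sym2.eq_iff.1 he
        · exact ⟨this, .inl (hc i hi)⟩
        · exact ⟨this.symm, .inr (hc i hi)⟩

lemma lapMatrix_apply_of_ne {V : Type*} [Fintype V] (G : SimpleGraph V) {a b : V} (h : a ≠ b) :
    G.lapMatrix ℝ a b = if G.Adj a b then -1 else 0 := by
  rw [SimpleGraph.lapMatrix, Matrix.sub_apply, SimpleGraph.degMatrix, Matrix.diagonal_apply_ne _ h,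
    SimpleGraph.adjMatrix_apply]
  split_ifs <;> simp

lemma lapMatrix_apply_self {V : Type*} [Fintype V] (G : SimpleGraph V) (a : V) :
    G.lapMatrix ℝ a a = G.degree a := by
  simp [SimpleGraph.lapMatrix, SimpleGraph.degMatrix]

/-- The permutations with `σ u = v`, `σ v ≠ u` contribute the sum over the cycles through `uv`. -/
lemma sum_prod_lapMatrix_eq_finsum_cycle {V : Type*} [Fintype V] (G : SimpleGraph V) {u v : V}
    (huv : G.Adj u v) :
    ∑ σ : Equiv.Perm V with σ u = v ∧ σ v ≠ u, ∏ i, G.lapMatrix ℝ (σ i) i =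
      ∑ᶠ C ∈ {C : G.Subgraph | IsCycleSubgraph G C ∧ C.Adj u v},
        (-1 : ℝ) ^ C.verts.ncard * permDel G C.verts := by
  rw [sum_prod_eq_sum_cycle _ huv.ne,
    ← Finset.sum_filter_of_ne (p := fun c : Equiv.Perm V => ∀ i, c i ≠ i → G.Adj i (c i)),
    ← finsum_mem_coe_finset]
  · refine finsum_mem_eq_of_bijOn (permSubgraph G) ⟨?_, ?_, ?_⟩ ?_
    · intro c hc
      simp only [Finset.coe_filter, Finset.mem_filter, Finset.mem_univ, true_and,
        Set.mem_ofPred_eq] at hc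
      obtain ⟨⟨hc, hcu, hcv⟩, hadj⟩ := hc
      exact ⟨isCycleSubgraph_permSubgraph huv.ne hc hcu hcv hadj, huv, .inl hcu⟩
    · intro c hc d hd h
      simp only [Finset.coe_filter, Finset.mem_filter, Finset.mem_univ, true_and,
        Set.mem_ofPred_eq] at hc hd
      exact permSubgraph_injOn huv.ne hc.1.1 hc.1.2.1 hd.1.2.1 hd.1.2.2 hd.2 h
    · rintro C ⟨hC, hCuv⟩
      obtain ⟨c, hc, hadj, h⟩ := exists_permSubgraph_eq hC hCuv
      refine ⟨c, ?_, h⟩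
      simp only [Finset.coe_filter, Finset.mem_filter, Finset.mem_univ, true_and,
        Set.mem_ofPred_eq]
      exact ⟨hc, hadj⟩
    · intro c hc
      simp only [Finset.coe_filter, Finset.mem_filter, Finset.mem_univ, true_and,
        Set.mem_ofPred_eq] at hc
      have hcard : (permSubgraph G c).verts.ncard = ({i | c i ≠ i} : Finset V).card := by
        rw [← Set.ncard_coe_finset]
        congr 1
        ext
        simp [permSubgraph]
      rw [hcard, ← Finset.prod_const]
      refine congrArg₂ (· * ·) (Finset.prod_congr (by congr!) fun i hi => ?_) rfl
      have hi : c i ≠ i := (Finset.mem_filter.1 hi).2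
      rw [lapMatrix_apply_of_ne _ hi, if_pos (hc.2 i hi).symm]
  · intro c _ hne i hi
    by_contra h
    refine hne (mul_eq_zero_of_left (Finset.prod_eq_zero (i := i) ?_ ?_) _)
    · exact (Finset.mem_filter_univ _).2 hi
    · rw [lapMatrix_apply_of_ne _ hi, if_neg fun h' => h h'.symm]

lemma sum_prod_perm_inv {V : Type*} [Fintype V] {M : Matrix V V ℝ} (hM : M.IsSymm) (u v : V) :
    ∑ σ : Equiv.Perm V with σ v = u ∧ σ u ≠ v, ∏ i, M (σ i) i =
      ∑ σ : Equiv.Perm V with σ u = v ∧ σ v ≠ u, ∏ i, M (σ i) i := by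
  refine Finset.sum_equiv (Equiv.inv _) (fun σ => ?_) fun σ _ => ?_
  · simp only [Finset.mem_filter_univ, Equiv.inv_apply, ne_eq, Equiv.Perm.inv_eq_iff_eq]
    grind
  · refine Finset.prod_equiv σ (by simp) fun i _ => ?_
    rw [Equiv.inv_apply, Equiv.Perm.inv_def, Equiv.symm_apply_apply, hM.apply]

lemma lapMatrix_deleteEdges_of_ne {V : Type*} [Fintype V] {G H : SimpleGraph V} {u v a b : V}
    (hH : H = G.deleteEdges {s(u, v)})
    (hab : ¬(a = b ∧ (a = u ∨ a = v))) (huv : s(a, b) ≠ s(u, v)) :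
    H.lapMatrix ℝ a b = G.lapMatrix ℝ a b := by
  by_cases h : a = b
  · subst h
    rw [lapMatrix_apply_self, lapMatrix_apply_self, ← SimpleGraph.card_neighborFinset_eq_degree,
      ← SimpleGraph.card_neighborFinset_eq_degree]
    congr 2
    ext c
    simp only [SimpleGraph.mem_neighborFinset, hH, SimpleGraph.deleteEdges_adj, Set.mem_singleton_iff]
    grind
  · rw [lapMatrix_apply_of_ne _ h, lapMatrix_apply_of_ne _ h]
    simp [hH, SimpleGraph.deleteEdges_adj, huv]

lemma lapMatrix_deleteEdges_left {V : Type*} [Fintype V] {G H : SimpleGraph V} {u v : V}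
    (hH : H = G.deleteEdges {s(u, v)})
    (huv : G.Adj u v) :
    G.lapMatrix ℝ u u = H.lapMatrix ℝ u u + 1 := by
  rw [lapMatrix_apply_self, lapMatrix_apply_self, ← SimpleGraph.card_neighborFinset_eq_degree,
    ← SimpleGraph.card_neighborFinset_eq_degree]
  have : G.neighborFinset u = insert v (H.neighborFinset u) := by
    ext c
    simp only [SimpleGraph.mem_neighborFinset, hH, SimpleGraph.deleteEdges_adj, Set.mem_singleton_iff,
      Finset.mem_insert]
    grind
  rw [this, Finset.card_insert_of_notMem (by simp [hH, SimpleGraph.deleteEdges_adj])]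
  push_cast
  rfl

lemma lapMatrix_deleteEdges_right {V : Type*} [Fintype V] {G H : SimpleGraph V} {u v : V}
    (hH : H = G.deleteEdges {s(u, v)})
    (huv : G.Adj u v) :
    G.lapMatrix ℝ v v = H.lapMatrix ℝ v v + 1 := by
  exact lapMatrix_deleteEdges_left (hH.trans (by rw [Sym2.eq_swap])) huv.symm

lemma sum_prod_ne_of_fixed {V : Type*} [Fintype V] (G : SimpleGraph V) (v : V) :
    ∑ σ : Equiv.Perm V with σ v = v, ∏ i with i ≠ v, G.lapMatrix ℝ (σ i) i = permDel G {v} := by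
  rw [← sum_prod_compl_of_agree G {v} 1 fun _ _ => rfl]
  exact Finset.sum_congr (by ext; simp) fun σ _ => Finset.prod_congr (by ext; simp) fun _ _ => rfl

lemma sum_prod_ne_of_agree_pair {V : Type*} [Fintype V] (G : SimpleGraph V) {u v a b : V}
    (c : Equiv.Perm V) (hu : c u = a) (hv : c v = b) (hc : ∀ i, i ≠ u ∧ i ≠ v → c i = i) :
    ∑ σ : Equiv.Perm V with σ u = a ∧ σ v = b,
      ∏ i with i ≠ u ∧ i ≠ v, G.lapMatrix ℝ (σ i) i = permDel G {u, v} := by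
  subst hu hv
  rw [← sum_prod_compl_of_agree G {u, v} c fun i hi => hc i (by simpa using hi)]
  exact Finset.sum_congr (by ext; simp) fun σ _ => Finset.prod_congr (by ext; simp) fun _ _ => rfl

lemma prod_eq_mul_mul_prod_ne {V : Type*} [Fintype V] {u v : V} (huv : u ≠ v)
    (f : V → ℝ) : ∏ i, f i = f u * f v * ∏ i with i ≠ u ∧ i ≠ v, f i := by
  rw [← Finset.prod_filter_not_mul_prod_filter _ (fun i => i ≠ u ∧ i ≠ v), ← Finset.prod_pair huv]
  congr 2
  ext
  simp only [Finset.mem_filter_univ, Finset.mem_insert, Finset.mem_singleton]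
  tauto

lemma prod_ne_eq_mul_prod_ne {V : Type*} [Fintype V] {u v : V} (huv : u ≠ v) (f : V → ℝ) :
    ∏ i with i ≠ v, f i = f u * ∏ i with i ≠ u ∧ i ≠ v, f i := by
  rw [← Finset.prod_insert (by simp)]
  congr 1
  ext i
  simp only [Finset.mem_filter_univ, Finset.mem_insert]
  grind

/-- expansion of the permanent of the Laplacian at an edge `e = uv`. -/
theorem permL_edge_expansion {V : Type*} [Fintype V] (G : SimpleGraph V) (u v : V)
    (huv : G.Adj u v) :
    permL G = permL (G.deleteEdges {s(u, v)})
      + permDel (G.deleteEdges {s(u, v)}) {v}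
      + permDel (G.deleteEdges {s(u, v)}) {u}
      + 2 * permDel G {u, v}
      + 2 * ∑ᶠ C ∈ {C : G.Subgraph | IsCycleSubgraph G C ∧ C.Adj u v},
          (-1 : ℝ) ^ C.verts.ncard * permDel G C.verts := by
  rw [← sum_prod_lapMatrix_eq_finsum_cycle G huv]
  obtain ⟨H, hH⟩ : ∃ H, H = G.deleteEdges {s(u, v)} := ⟨_, rfl⟩
  rw [← hH]
  have hne := huv.ne
  have hcycle := sum_prod_perm_inv (M := G.lapMatrix ℝ) (G.isSymm_lapMatrix ℝ) u v
  have hfixed := sum_prod_ne_of_agree_pair G (u := u) (v := v) 1 (Equiv.Perm.one_apply u) (Equiv.Perm.one_apply v) fun _ _ => rfl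
  have hswap := sum_prod_ne_of_agree_pair G (Equiv.swap u v) (Equiv.swap_apply_left u v)
    (Equiv.swap_apply_right u v) fun i hi => Equiv.swap_apply_of_ne_of_ne hi.1 hi.2
  rw [two_mul, two_mul]
  nth_rewrite 1 [← hfixed]
  rw [← hswap]
  nth_rewrite 2 [← hcycle]
  rw [← sum_prod_ne_of_fixed H, ← sum_prod_ne_of_fixed H, permL, permL, Matrix.permanent,
    Matrix.permanent]
  simp only [Finset.sum_filter, ← Finset.sum_add_distrib]
  refine Finset.sum_congr rfl fun σ _ => ?_
  have hP : ∏ i with i ≠ u ∧ i ≠ v, H.lapMatrix ℝ (σ i) i =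
      ∏ i with i ≠ u ∧ i ≠ v, G.lapMatrix ℝ (σ i) i := by
    refine Finset.prod_congr rfl fun i hi => ?_
    have hi : i ≠ u ∧ i ≠ v := (Finset.mem_filter.1 hi).2
    exact lapMatrix_deleteEdges_of_ne hH (by grind) (by grind)
  have hcomm : ∏ i with i ≠ v ∧ i ≠ u, H.lapMatrix ℝ (σ i) i =
      ∏ i with i ≠ u ∧ i ≠ v, H.lapMatrix ℝ (σ i) i := by simp only [and_comm]
  simp only [prod_eq_mul_mul_prod_ne hne]
  rw [prod_ne_eq_mul_prod_ne hne, prod_ne_eq_mul_prod_ne hne.symm, hcomm, hP]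
  have hGu := lapMatrix_deleteEdges_left hH huv
  have hGv := lapMatrix_deleteEdges_right hH huv
  have hGuv : G.lapMatrix ℝ u v = -1 := by rw [lapMatrix_apply_of_ne _ hne, if_pos huv]
  have hGvu : G.lapMatrix ℝ v u = -1 := by rw [lapMatrix_apply_of_ne _ hne.symm, if_pos huv.symm]
  have hHuv : H.lapMatrix ℝ u v = 0 := by
    rw [lapMatrix_apply_of_ne _ hne, if_neg (by simp [hH])]
  have hHvu : H.lapMatrix ℝ v u = 0 := by
    rw [lapMatrix_apply_of_ne _ hne.symm, if_neg (by simp [hH, Sym2.eq_swap])]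
  have hu : ∀ a, a ≠ u → a ≠ v → H.lapMatrix ℝ a u = G.lapMatrix ℝ a u := fun a hau hav =>
    lapMatrix_deleteEdges_of_ne hH (by grind) (by grind)
  have hv : ∀ a, a ≠ u → a ≠ v → H.lapMatrix ℝ a v = G.lapMatrix ℝ a v := fun a hau hav =>
    lapMatrix_deleteEdges_of_ne hH (by grind) (by grind)
  have hinj : σ u ≠ σ v := fun h => hne (σ.injective h)
  generalize σ u = a at hinj ⊢
  generalize σ v = b at hinj ⊢
  by_cases hau : a = u
  · subst hau
    by_cases hbv : b = v
    · subst hbv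
      simp [hne, hne.symm, hGu, hGv]
      ring
    · simp [hne, hbv, hinj.symm, hGu, hv b hinj.symm hbv]
      ring
  by_cases hav : a = v
  · subst hav
    by_cases hbu : b = u
    · subst hbu
      simp [hne, hne.symm, hGuv, hGvu, hHuv, hHvu]
    · simp [hne.symm, hbu, hinj.symm, hGvu, hHvu]
  by_cases hbu : b = u
  · subst hbu
    simp [hne, hau, hav, hGuv, hHuv]
  by_cases hbv : b = v
  · subst hbv
    simp [hne.symm, hau, hav, hGv, hu a hau hav]
    ring
  · simp [hau, hav, hbu, hbv, hu a hau hav, hv b hbu hbv]
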